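/- arXiv:1711.00127 — 3 statements merged into one kernel-verified Lean document; each statement's English description precedes it below -/
import Mathlib

section
/- For every integer k ≥ 3, ∫_{−2√(k−1)}^{2√(k−1)} k·√(4(k−1) − q²) / (2π(k² − q²)) dq = 1; that is, the Kesten–McKay law μ_k is a probability measure on ℝ. -/
open MeasureTheory

/-- The Kesten–McKay law `μ_k`: the measure on `ℝ` with density
`q ↦ 1_{(−2√(k−1), 2√(k−1))}(q) · k√(4(k−1) − q²) / (2π(k² − q²))`
with respect to Lebesgue measure. -/
noncomputable def kestenMcKay (k : ℕ) : Measure ℝ :=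
  volume.withDensity fun q =>
    ENNReal.ofReal
      (Set.indicator
        (Set.Ioo (-(2 * Real.sqrt ((k : ℝ) - 1))) (2 * Real.sqrt ((k : ℝ) - 1)))
        (fun q => (k : ℝ) * Real.sqrt (4 * ((k : ℝ) - 1) - q ^ 2) /
          (2 * Real.pi * ((k : ℝ) ^ 2 - q ^ 2))) q)

/-- The explicit antiderivative of the Kesten–McKay density has the right derivative. -/
lemma km_hasDerivAt (K c a q : ℝ) (hc : 0 < c) (hK : K = c + 2) (ha : 0 < a)
    (ha2 : a ^ 2 = 4 * (K - 1)) (hq : q ^ 2 < a ^ 2) :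
    HasDerivAt (fun q => K / (2 * Real.pi) * (Real.arcsin (q / a) -
      c / K * Real.arcsin (c * q / (a * Real.sqrt (K ^ 2 - q ^ 2)))))
      (K * Real.sqrt (4 * (K - 1) - q ^ 2) / (2 * Real.pi * (K ^ 2 - q ^ 2))) q := by
  have hK0 : 0 < K := by linarith
  have hKa : K ^ 2 - a ^ 2 = c ^ 2 := by rw [ha2, hK]; ring
  have hW : 0 < K ^ 2 - q ^ 2 := by nlinarith [sq_pos_of_pos hc]
  have hS : 0 < a ^ 2 - q ^ 2 := by linarith
  obtain ⟨w, hw⟩ : ∃ w, w = Real.sqrt (K ^ 2 - q ^ 2) := ⟨_, rfl⟩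
  obtain ⟨s, hs⟩ : ∃ s, s = Real.sqrt (a ^ 2 - q ^ 2) := ⟨_, rfl⟩
  have hw0 : 0 < w := by rw [hw]; exact Real.sqrt_pos.2 hW
  have hs0 : 0 < s := by rw [hs]; exact Real.sqrt_pos.2 hS
  have hw2 : w ^ 2 = K ^ 2 - q ^ 2 := by rw [hw]; exact Real.sq_sqrt hW.le
  have hs2 : s ^ 2 = a ^ 2 - q ^ 2 := by rw [hs]; exact Real.sq_sqrt hS.le
  have e1 : 1 - (q / a) ^ 2 = (s / a) ^ 2 := by
    rw [div_pow, div_pow, hs2]; field_simp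
  have e2 : 1 - (c * q / (a * w)) ^ 2 = (K * s / (a * w)) ^ 2 := by
    have : a ^ 2 * w ^ 2 - c ^ 2 * q ^ 2 = K ^ 2 * s ^ 2 := by
      rw [hw2, hs2, ← hKa]; ring
    rw [div_pow, div_pow]
    field_simp
    linarith
  have p1 : 0 < s / a := by positivity
  have p2 : 0 < K * s / (a * w) := by positivity
  have n1 : q / a ≠ -1 := fun h => by rw [h] at e1; nlinarith [pow_pos p1 2]
  have n1' : q / a ≠ 1 := fun h => by rw [h] at e1; nlinarith [pow_pos p1 2]
  have n2 : c * q / (a * w) ≠ -1 := fun h => by rw [h] at e2; nlinarith [pow_pos p2 2]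
  have n2' : c * q / (a * w) ≠ 1 := fun h => by rw [h] at e2; nlinarith [pow_pos p2 2]
  have d1 : HasDerivAt (fun q : ℝ => Real.arcsin (q / a)) (1 / s) q := by
    have := (Real.hasDerivAt_arcsin n1 n1').comp q ((hasDerivAt_id q).div_const a)
    rw [e1, Real.sqrt_sq p1.le] at this
    refine this.congr_deriv ?_
    field_simp
  have dw : HasDerivAt (fun q : ℝ => Real.sqrt (K ^ 2 - q ^ 2)) (-q / w) q := by
    have h0 : HasDerivAt (fun q : ℝ => K ^ 2 - q ^ 2) (-(2 * q)) q := by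
      simpa using ((hasDerivAt_id q).pow 2).const_sub (K ^ 2)
    have := h0.sqrt hW.ne'
    rw [← hw] at this
    refine this.congr_deriv ?_
    field_simp
  have du : HasDerivAt (fun q : ℝ => c * q / (a * Real.sqrt (K ^ 2 - q ^ 2)))
      (c * K ^ 2 / (a * w ^ 3)) q := by
    have := ((hasDerivAt_id q).const_mul c).div (dw.const_mul a)
      (by rw [← hw]; positivity)
    rw [← hw] at this
    refine this.congr_deriv ?_
    have : K ^ 2 = w ^ 2 + q ^ 2 := by linarith
    rw [this]
    simp only [id]
    field_simp
    ring
  have d2 : HasDerivAt (fun q : ℝ => Real.arcsin (c * q / (a * Real.sqrt (K ^ 2 - q ^ 2))))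
      (c * K / (w ^ 2 * s)) q := by
    have hh : HasDerivAt Real.arcsin (1 / Real.sqrt (1 - (c * q / (a * w)) ^ 2))
      (c * q / (a * Real.sqrt (K ^ 2 - q ^ 2))) := by
      rw [← hw]; exact Real.hasDerivAt_arcsin n2 n2'
    have := hh.comp q du
    rw [e2, Real.sqrt_sq p2.le] at this
    refine this.congr_deriv ?_
    field_simp
  refine ((d1.sub (d2.const_mul (c / K))).const_mul (K / (2 * Real.pi))).congr_deriv ?_
  rw [← ha2, ← hs, ← hw2]
  have hpi := Real.pi_pos
  have : w ^ 2 - c ^ 2 = s ^ 2 := by rw [hw2, hs2]; linarith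
  field_simp
  linarith

/-- For every integer `k ≥ 3`, the Kesten–McKay density integrates to `1`;
that is, `μ_k` is a probability measure on `ℝ`. -/
theorem stmt3 (k : ℕ) (hk : 3 ≤ k) :
    (∫ q in Set.Ioo (-(2 * Real.sqrt ((k : ℝ) - 1))) (2 * Real.sqrt ((k : ℝ) - 1)),
        (k : ℝ) * Real.sqrt (4 * ((k : ℝ) - 1) - q ^ 2) /
          (2 * Real.pi * ((k : ℝ) ^ 2 - q ^ 2))) = 1 ∧
    IsProbabilityMeasure (kestenMcKay k) := by
  obtain ⟨K, hKk⟩ : ∃ K : ℝ, K = k := ⟨_, rfl⟩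
  have hK3 : 3 ≤ K := by rw [hKk]; exact_mod_cast hk
  unfold kestenMcKay
  rw [← hKk]
  obtain ⟨a, hae⟩ : ∃ a, a = 2 * Real.sqrt (K - 1) := ⟨_, rfl⟩
  have ha : 0 < a := by
    rw [hae]; have := Real.sqrt_pos.2 (show 0 < K - 1 by linarith); positivity
  have ha2 : a ^ 2 = 4 * (K - 1) := by
    rw [hae, mul_pow, Real.sq_sqrt (by linarith)]; norm_num
  rw [← hae]
  have hKa : K ^ 2 - a ^ 2 = (K - 2) ^ 2 := by rw [ha2]; ring
  have hc : 0 < K - 2 := by linarith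
  have hd : ∀ q ∈ Set.Ioo (-a) a, HasDerivAt (fun q => K / (2 * Real.pi) * (Real.arcsin (q / a) -
      (K - 2) / K * Real.arcsin ((K - 2) * q / (a * Real.sqrt (K ^ 2 - q ^ 2)))))
      (K * Real.sqrt (4 * (K - 1) - q ^ 2) / (2 * Real.pi * (K ^ 2 - q ^ 2))) q :=
    fun q hq => km_hasDerivAt K (K - 2) a q hc (by ring) ha ha2
      (by nlinarith [hq.1, hq.2])
  have hW : ∀ q ∈ Set.Icc (-a) a, 0 < K ^ 2 - q ^ 2 := fun q hq => by
    nlinarith [hq.1, hq.2, pow_pos hc 2]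
  have hcont : ContinuousOn (fun q => K / (2 * Real.pi) * (Real.arcsin (q / a) -
      (K - 2) / K * Real.arcsin ((K - 2) * q / (a * Real.sqrt (K ^ 2 - q ^ 2)))))
      (Set.Icc (-a) a) := by
    refine continuousOn_const.mul (ContinuousOn.sub ?_ (continuousOn_const.mul ?_))
    · exact (Real.continuous_arcsin.comp (by fun_prop)).continuousOn
    · refine Real.continuous_arcsin.comp_continuousOn (ContinuousOn.div (by fun_prop)
        (by fun_prop) fun q hq => ?_)
      exact (mul_pos ha (Real.sqrt_pos.2 (hW q hq))).ne'
  have hpos : ∀ q ∈ Set.Ioo (-a) a,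
      0 ≤ K * Real.sqrt (4 * (K - 1) - q ^ 2) / (2 * Real.pi * (K ^ 2 - q ^ 2)) :=
    fun q hq => by
      have := hW q ⟨hq.1.le, hq.2.le⟩
      have := Real.pi_pos
      positivity
  have hint := intervalIntegral.integrableOn_deriv_of_nonneg hcont hd hpos
  have hI : (∫ q in Set.Ioo (-a) a,
      K * Real.sqrt (4 * (K - 1) - q ^ 2) / (2 * Real.pi * (K ^ 2 - q ^ 2))) = 1 := by
    rw [← integral_Ioc_eq_integral_Ioo, ← intervalIntegral.integral_of_le (by linarith),
      intervalIntegral.integral_eq_sub_of_hasDerivAt_of_le (by linarith) hcont hd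
        ((intervalIntegrable_iff_integrableOn_Ioc_of_le (by linarith)).2 hint)]
    have hpi := Real.pi_pos
    have hs : Real.sqrt (K ^ 2 - a ^ 2) = K - 2 := by rw [hKa, Real.sqrt_sq hc.le]
    have h1 : (K - 2) * a / (a * (K - 2)) = 1 := by field_simp
    have h2 : (K - 2) * -a / (a * (K - 2)) = -1 := by field_simp
    have h3 : a / a = 1 := by field_simp
    have h4 : -a / a = -1 := by field_simp
    have hK0 : K ≠ 0 := by linarith
    simp only [neg_sq, hs, h1, h2, h3, h4, Real.arcsin_one, Real.arcsin_neg_one]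
    field_simp
    ring
  refine ⟨hI, ⟨?_⟩⟩
  rw [withDensity_apply _ MeasurableSet.univ, Measure.restrict_univ,
    ← ofReal_integral_eq_lintegral_ofReal, integral_indicator measurableSet_Ioo, hI]
  · simp
  · exact (integrable_indicator_iff measurableSet_Ioo).2 (hint.mono_set Set.Ioo_subset_Ioc_self)
  · exact Filter.Eventually.of_forall fun q => Set.indicator_nonneg hpos q
end

section
/- For every integer k ≥ 3, the series Σ_{ℓ=0}^∞ ∫_ℝ (q/k)^ℓ μ_k(dq) is absolutely convergent and Σ_{ℓ=0}^∞ ∫_ℝ (q/k)^ℓ μ_k(dq) = ∫_ℝ 1/(1 − q/k) μ_k(dq) = (k−1)/(k−2). -/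
open MeasureTheory

section KM
variable {a b k q : ℝ}

/-- derivative of the first arcsine -/
lemma km_A1 (ha : 0 < a) (hb : 0 < b) (hab : a ^ 2 + b ^ 2 = k ^ 2) (hak : a < k)
    (h1 : -a < q) (h2 : q < a) :
    HasDerivAt (fun q => Real.arcsin ((k * q - a ^ 2) / (a * (k - q))))
      (b / ((k - q) * Real.sqrt (a ^ 2 - q ^ 2))) q := by
  have hkq : 0 < k - q := by linarith
  have hs : 0 < a ^ 2 - q ^ 2 := by nlinarith
  have hss := Real.sqrt_pos.2 hs
  have hu : HasDerivAt (fun q => (k * q - a ^ 2) / (a * (k - q)))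
      (b ^ 2 / (a * (k - q) ^ 2)) q := by
    have := (((hasDerivAt_id q).const_mul k).sub_const (a ^ 2)).div
      (((hasDerivAt_id q).const_sub k).const_mul a) (mul_pos ha hkq).ne'
    refine this.congr_deriv ?_
    simp only [id]
    have hb2 : b ^ 2 = k ^ 2 - a ^ 2 := by linarith
    rw [hb2]
    field_simp
    ring
  have h1u : 1 - ((k * q - a ^ 2) / (a * (k - q))) ^ 2
      = (b * Real.sqrt (a ^ 2 - q ^ 2) / (a * (k - q))) ^ 2 := by
    rw [div_pow, div_pow, mul_pow b, Real.sq_sqrt hs.le]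
    have hb2 : b ^ 2 = k ^ 2 - a ^ 2 := by linarith
    rw [hb2]
    field_simp
    ring
  have hpos : 0 < b * Real.sqrt (a ^ 2 - q ^ 2) / (a * (k - q)) := by positivity
  have hlt : 0 < 1 - ((k * q - a ^ 2) / (a * (k - q))) ^ 2 := by rw [h1u]; positivity
  have := (Real.hasDerivAt_arcsin (x := (k * q - a ^ 2) / (a * (k - q)))
    (by intro h; rw [h] at hlt; norm_num at hlt)
    (by intro h; rw [h] at hlt; norm_num at hlt)).comp q hu
  refine this.congr_deriv ?_
  rw [h1u, Real.sqrt_sq hpos.le]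
  field_simp

lemma km_A2 (ha : 0 < a) (hb : 0 < b) (hab : a ^ 2 + b ^ 2 = k ^ 2) (hak : a < k)
    (h1 : -a < q) (h2 : q < a) :
    HasDerivAt (fun q => - Real.arcsin ((k * (-q) - a ^ 2) / (a * (k - (-q)))))
      (b / ((k + q) * Real.sqrt (a ^ 2 - q ^ 2))) q := by
  have h := (km_A1 (q := -q) ha hb hab hak (by linarith) (by linarith))
  have := (h.comp q (hasDerivAt_neg q)).neg
  refine this.congr_deriv ?_
  simp

lemma km_A0 (ha : 0 < a) (h1 : -a < q) (h2 : q < a) :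
    HasDerivAt (fun q => Real.arcsin (q / a)) (1 / Real.sqrt (a ^ 2 - q ^ 2)) q := by
  have hs : 0 < a ^ 2 - q ^ 2 := by nlinarith
  have hss := Real.sqrt_pos.2 hs
  have h1u : 1 - (q / a) ^ 2 = (Real.sqrt (a ^ 2 - q ^ 2) / a) ^ 2 := by
    rw [div_pow, div_pow, Real.sq_sqrt hs.le]
    field_simp
  have hpos : 0 < Real.sqrt (a ^ 2 - q ^ 2) / a := by positivity
  have hlt : 0 < 1 - (q / a) ^ 2 := by rw [h1u]; positivity
  have := (Real.hasDerivAt_arcsin (x := q / a)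
    (by intro h; rw [h] at hlt; norm_num at hlt)
    (by intro h; rw [h] at hlt; norm_num at hlt)).comp q ((hasDerivAt_id q).div_const a)
  refine this.congr_deriv ?_
  rw [h1u, Real.sqrt_sq hpos.le]
  field_simp

lemma km_S (ha : 0 < a) (h1 : -a < q) (h2 : q < a) :
    HasDerivAt (fun q => Real.sqrt (a ^ 2 - q ^ 2)) (- q / Real.sqrt (a ^ 2 - q ^ 2)) q := by
  have hs : 0 < a ^ 2 - q ^ 2 := by nlinarith
  have hss := Real.sqrt_pos.2 hs
  have := (((hasDerivAt_id q).pow 2).const_sub (a ^ 2)).sqrt hs.ne'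
  refine this.congr_deriv ?_
  simp
  field_simp

/-- the antiderivative -/
noncomputable def kmF (a b k q : ℝ) : ℝ :=
  k / 2 * (Real.sqrt (a ^ 2 - q ^ 2) / (k - q)
      + k / b * Real.arcsin ((k * q - a ^ 2) / (a * (k - q))) - Real.arcsin (q / a))
    + 1 / 4 * (2 * k * Real.arcsin (q / a)
      - b * Real.arcsin ((k * q - a ^ 2) / (a * (k - q)))
      - b * (- Real.arcsin ((k * (-q) - a ^ 2) / (a * (k - (-q))))))

lemma kmF_deriv (ha : 0 < a) (hb : 0 < b) (hab : a ^ 2 + b ^ 2 = k ^ 2) (hak : a < k)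
    (h1 : -a < q) (h2 : q < a) :
    HasDerivAt (kmF a b k)
      (k ^ 2 * Real.sqrt (a ^ 2 - q ^ 2) / ((k ^ 2 - q ^ 2) * (k - q))) q := by
  have hkq : 0 < k - q := by linarith
  have hkq' : 0 < k + q := by linarith
  have hs : 0 < a ^ 2 - q ^ 2 := by nlinarith
  have hss := Real.sqrt_pos.2 hs
  have hsq := Real.sq_sqrt hs.le
  have hA1 := km_A1 ha hb hab hak h1 h2
  have hA2 := km_A2 ha hb hab hak h1 h2
  have hA0 := km_A0 ha h1 h2
  have hS := km_S ha h1 h2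
  have := (((hS.div ((hasDerivAt_id q).const_sub k) hkq.ne').add
      (hA1.const_mul (k / b))).sub hA0).const_mul (k / 2) |>.add
    ((((hA0.const_mul (2 * k)).sub (hA1.const_mul b)).sub (hA2.const_mul b)).const_mul (1 / 4))
  refine this.congr_deriv ?_
  simp only [id]
  have hk2 : k ^ 2 - q ^ 2 = (k - q) * (k + q) := by ring
  rw [hk2]
  generalize Real.sqrt (a ^ 2 - q ^ 2) = s at *
  have hb2 : b ^ 2 = k ^ 2 - q ^ 2 - s ^ 2 := by linarith
  field_simp
  rw [hb2]
  ring

lemma km_integral (ha : 0 < a) (hb : 0 < b) (hab : a ^ 2 + b ^ 2 = k ^ 2) (hak : a < k) :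
    ∫ q in (-a)..a, k ^ 2 * Real.sqrt (a ^ 2 - q ^ 2) / ((k ^ 2 - q ^ 2) * (k - q))
      = Real.pi * (k / 2 * (k / b - 1) + 1 / 2 * (k - b)) := by
  have hden : ∀ q ∈ Set.Icc (-a) a, 0 < k - q ∧ 0 < k + q := fun q hq =>
    ⟨by linarith [hq.2], by linarith [hq.1]⟩
  rw [intervalIntegral.integral_eq_sub_of_hasDerivAt_of_le (f := kmF a b k) (by linarith)
    ?_ (fun q hq => kmF_deriv ha hb hab hak hq.1 hq.2) ?_]
  · have e1 : (k * a - a ^ 2) / (a * (k - a)) = 1 := by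
      have : k - a ≠ 0 := by linarith
      field_simp
    have e2 : (k * (-a) - a ^ 2) / (a * (k - (-a))) = -1 := by
      have : k - (-a) ≠ 0 := by linarith
      field_simp
      ring
    have e3 : -a / a = -1 := by field_simp
    have e4 : a / a = 1 := by field_simp
    simp only [kmF, neg_neg, e1, e2, e3, e4, Real.arcsin_one, Real.arcsin_neg_one, neg_sq,
      sub_self, Real.sqrt_zero, zero_div]
    field_simp
    ring
  · have c1 : ContinuousOn (fun q => (k * q - a ^ 2) / (a * (k - q))) (Set.Icc (-a) a) :=
      ContinuousOn.div (by fun_prop) (by fun_prop)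
        (fun q hq => (mul_pos ha (hden q hq).1).ne')
    have c2 : ContinuousOn (fun q => (k * (-q) - a ^ 2) / (a * (k - (-q)))) (Set.Icc (-a) a) :=
      ContinuousOn.div (by fun_prop) (by fun_prop)
        (fun q hq => (mul_pos ha (by linarith [(hden q hq).2])).ne')
    have c3 : ContinuousOn (fun q => Real.sqrt (a ^ 2 - q ^ 2) / (k - q)) (Set.Icc (-a) a) :=
      ContinuousOn.div (by fun_prop) (by fun_prop) (fun q hq => (hden q hq).1.ne')
    have d1 := Real.continuous_arcsin.comp_continuousOn c1
    have d2 := Real.continuous_arcsin.comp_continuousOn c2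
    have d0 : ContinuousOn (fun q => Real.arcsin (q / a)) (Set.Icc (-a) a) :=
      (Real.continuous_arcsin.comp (continuous_id.div_const a)).continuousOn
    exact (continuousOn_const.mul ((c3.add (continuousOn_const.mul d1)).sub d0)).add
      (continuousOn_const.mul (((continuousOn_const.mul d0).sub (continuousOn_const.mul d1)).sub
        (continuousOn_const.mul d2.neg)))
  · apply ContinuousOn.intervalIntegrable
    rw [Set.uIcc_of_le (by linarith)]
    refine ContinuousOn.div (by fun_prop) (by fun_prop) (fun q hq => ?_)
    obtain ⟨h1, h2⟩ := hden q hq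
    have : (k ^ 2 - q ^ 2) * (k - q) = (k - q) * (k + q) * (k - q) := by ring
    rw [this]
    positivity

end KM

/-- the real density -/
noncomputable def kmD (k : ℕ) : ℝ → ℝ :=
  Set.indicator
        (Set.Ioo (-(2 * Real.sqrt ((k : ℝ) - 1))) (2 * Real.sqrt ((k : ℝ) - 1)))
        (fun q => (k : ℝ) * Real.sqrt (4 * ((k : ℝ) - 1) - q ^ 2) /
          (2 * Real.pi * ((k : ℝ) ^ 2 - q ^ 2)))

/-- For every integer `k ≥ 3`, the series `Σ_ℓ ∫ (q/k)^ℓ dμ_k` is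
absolutely convergent and equals `∫ 1/(1 − q/k) dμ_k = (k−1)/(k−2)`. -/
theorem stmt4 (k : ℕ) (hk : 3 ≤ k) :
    Summable (fun ℓ : ℕ => |∫ q, (q / (k : ℝ)) ^ ℓ ∂(kestenMcKay k)|) ∧
    (∑' ℓ : ℕ, ∫ q, (q / (k : ℝ)) ^ ℓ ∂(kestenMcKay k))
      = ∫ q, 1 / (1 - q / (k : ℝ)) ∂(kestenMcKay k) ∧
    (∫ q, 1 / (1 - q / (k : ℝ)) ∂(kestenMcKay k)) = ((k : ℝ) - 1) / ((k : ℝ) - 2) := by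
  have hk3 : (3 : ℝ) ≤ k := by exact_mod_cast hk
  set K : ℝ := (k : ℝ) with hK
  set a : ℝ := 2 * Real.sqrt (K - 1) with hadef
  have ha : 0 < a := by
    have := Real.sqrt_pos.2 (show 0 < K - 1 by linarith)
    positivity
  have ha2 : a ^ 2 = 4 * (K - 1) := by
    rw [hadef, mul_pow, Real.sq_sqrt (by linarith)]; norm_num
  have hak : a < K := by nlinarith
  have hK0 : 0 < K := by linarith
  have hD : kmD k = Set.indicator (Set.Ioo (-a) a) (fun q => K * Real.sqrt (a ^ 2 - q ^ 2) /
          (2 * Real.pi * (K ^ 2 - q ^ 2))) := by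
    rw [ha2]; rfl
  have hden : ∀ q ∈ Set.Icc (-a) a, 0 < K ^ 2 - q ^ 2 := fun q hq => by
    nlinarith [hq.1, hq.2]
  have hDm : Measurable (kmD k) := by
    rw [hD]
    exact Measurable.indicator (by fun_prop) measurableSet_Ioo
  have hD0 : ∀ q, 0 ≤ kmD k q := by
    intro q
    rw [hD]
    refine Set.indicator_nonneg (fun q hq => ?_) q
    have := hden q ⟨hq.1.le, hq.2.le⟩
    positivity
  have hDi : Integrable (kmD k) volume := by
    rw [hD, integrable_indicator_iff measurableSet_Ioo]
    refine IntegrableOn.mono_set (t := Set.Icc (-a) a) ?_ Set.Ioo_subset_Icc_self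
    apply ContinuousOn.integrableOn_Icc
    refine ContinuousOn.div (by fun_prop) (by fun_prop) (fun q hq => ?_)
    have := hden q hq
    positivity
  have hμ : kestenMcKay k = volume.withDensity (fun q => ENNReal.ofReal (kmD k q)) := rfl
  have hfin : IsFiniteMeasure (kestenMcKay k) := by
    rw [hμ]
    exact isFiniteMeasure_withDensity_ofReal hDi.2
  have hae : ∀ᵐ q ∂(kestenMcKay k), q ∈ Set.Ioo (-a) a := by
    rw [hμ, ae_withDensity_iff (by fun_prop)]
    refine Filter.Eventually.of_forall (fun q hq => ?_)
    by_contra hn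
    apply hq
    rw [hD, Set.indicator_of_notMem hn, ENNReal.ofReal_zero]
  have hr1 : a / K < 1 := (div_lt_one hK0).2 hak
  have hr0 : 0 ≤ a / K := by positivity
  have hae2 : ∀ᵐ q ∂(kestenMcKay k), |q / K| ≤ a / K := by
    filter_upwards [hae] with q hq
    rw [abs_div, abs_of_pos hK0]
    gcongr
    exact abs_le.2 ⟨hq.1.le, hq.2.le⟩
  have hb : ∀ l : ℕ, ∀ᵐ q ∂(kestenMcKay k), ‖(q / K) ^ l‖ ≤ (a / K) ^ l := by
    intro l
    filter_upwards [hae2] with q hq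
    rw [norm_pow, Real.norm_eq_abs]
    gcongr
  have hint : ∀ l : ℕ, Integrable (fun q : ℝ => (q / K) ^ l) (kestenMcKay k) := fun l =>
    Integrable.of_bound (by fun_prop) _ (hb l)
  have hle : ∀ l : ℕ, ∫ q, ‖(q / K) ^ l‖ ∂(kestenMcKay k)
      ≤ (a / K) ^ l * (kestenMcKay k).real Set.univ := by
    intro l
    have := integral_mono_ae (hint l).norm (integrable_const ((a / K) ^ l)) (hb l)
    rw [integral_const, smul_eq_mul, mul_comm] at this
    exact this
  have hgs : Summable (fun l : ℕ => (a / K) ^ l * (kestenMcKay k).real Set.univ) :=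
    (summable_geometric_of_lt_one hr0 hr1).mul_right _
  have hsn : Summable (fun l : ℕ => ∫ q, ‖(q / K) ^ l‖ ∂(kestenMcKay k)) :=
    Summable.of_nonneg_of_le (fun l => integral_nonneg (fun q => norm_nonneg _)) hle hgs
  refine ⟨?_, ?_, ?_⟩
  · exact Summable.of_nonneg_of_le (fun l => abs_nonneg _)
      (fun l => by rw [← Real.norm_eq_abs]; exact norm_integral_le_integral_norm _) hsn
  · rw [(hasSum_integral_of_summable_integral_norm hint hsn).tsum_eq]
    refine integral_congr_ae ?_
    filter_upwards [hae2] with q hq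
    rw [tsum_geometric_of_norm_lt_one (lt_of_le_of_lt hq hr1), one_div]
  · rw [hμ, integral_withDensity_eq_integral_toReal_smul (by fun_prop)
      (Filter.Eventually.of_forall fun q => ENNReal.ofReal_lt_top)]
    have h1 : (fun q => (ENNReal.ofReal (kmD k q)).toReal • (1 / (1 - q / K)))
        = Set.indicator (Set.Ioo (-a) a) (fun q => 1 / (2 * Real.pi) *
          (K ^ 2 * Real.sqrt (a ^ 2 - q ^ 2) / ((K ^ 2 - q ^ 2) * (K - q)))) := by
      funext q
      rw [ENNReal.toReal_ofReal (hD0 q), hD]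
      by_cases hq : q ∈ Set.Ioo (-a) a
      · rw [Set.indicator_of_mem hq, Set.indicator_of_mem hq, smul_eq_mul]
        have h3 := hden q ⟨hq.1.le, hq.2.le⟩
        have h4 : 0 < K - q := by linarith [hq.2]
        have h5 : 1 - q / K = (K - q) / K := by field_simp
        rw [h5]
        field_simp
      · rw [Set.indicator_of_notMem hq, Set.indicator_of_notMem hq, zero_smul]
    rw [h1, integral_indicator measurableSet_Ioo, ← integral_Ioc_eq_integral_Ioo,
      ← intervalIntegral.integral_of_le (by linarith), intervalIntegral.integral_const_mul,
      km_integral (b := K - 2) ha (by linarith) (by rw [ha2]; ring) hak]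
    have : K - 2 ≠ 0 := by linarith
    have := Real.pi_ne_zero
    field_simp
    ring
end

section
/- Let S be a real symmetric matrix indexed by a finite nonempty set E, let g ∈ (0,1), and suppose every eigenvalue of S lies in the set [−1+g, 1−g] ∪ {1}. Let P be the orthogonal projection onto the eigenspace {v : S v = v}. Then for every λ > 0 the matrix λ·I + 2(I − S) is invertible, and for every r ∈ ℕ and every vector v ∈ ℝ^E, 0 ≤ ⟨v, (λ·I + 2(I − S))^{−(r+1)} (I − P) v⟩ ≤ ‖v‖² / (λ + 2g)^{r+1}. -/
open Matrix

theorem stmt13_diag {E : Type*} [Fintype E] [DecidableEq E]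
    (S : Matrix E E ℝ) (hS : S.IsSymm) :
    ∃ (U : Matrix E E ℝ) (d : E → ℝ), U * Uᵀ = 1 ∧ Uᵀ * U = 1 ∧
      S = U * diagonal d * Uᵀ ∧ ∀ i, d i ∈ spectrum ℝ S := by
  have hH : S.IsHermitian := by
    rw [Matrix.IsHermitian, conjTranspose_eq_transpose_of_trivial]; exact hS
  refine ⟨hH.eigenvectorUnitary, hH.eigenvalues, ?_, ?_, ?_, ?_⟩
  · have := Unitary.coe_mul_star_self hH.eigenvectorUnitary
    rwa [Unitary.coe_star, star_eq_conjTranspose, conjTranspose_eq_transpose_of_trivial] at this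
  · have := Unitary.coe_star_mul_self hH.eigenvectorUnitary
    rwa [star_eq_conjTranspose, conjTranspose_eq_transpose_of_trivial] at this
  · have := hH.spectral_theorem
    rw [Unitary.conjStarAlgAut_apply, star_eq_conjTranspose,
      conjTranspose_eq_transpose_of_trivial] at this
    exact this
  · intro i
    exact hH.eigenvalues_mem_spectrum_real i

theorem stmt13_mul {E : Type*} [Fintype E] [DecidableEq E]
    (U : Matrix E E ℝ) (h : Uᵀ * U = 1) (a b : E → ℝ) :
    (U * diagonal a * Uᵀ) * (U * diagonal b * Uᵀ) = U * diagonal (fun i => a i * b i) * Uᵀ := by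
  rw [← diagonal_mul_diagonal]
  calc _ = U * diagonal a * (Uᵀ * U) * diagonal b * Uᵀ := by simp only [Matrix.mul_assoc]
    _ = _ := by rw [h]; simp only [Matrix.mul_assoc, Matrix.mul_one, Matrix.one_mul]

theorem stmt13_quad {E : Type*} [Fintype E] [DecidableEq E]
    (U : Matrix E E ℝ) (c v : E → ℝ) :
    v ⬝ᵥ ((U * diagonal c * Uᵀ).mulVec v) = ∑ i, c i * (Uᵀ.mulVec v i) ^ 2 := by
  rw [← mulVec_mulVec, ← mulVec_mulVec, dotProduct_mulVec, ← mulVec_transpose]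
  simp only [dotProduct, mulVec_diagonal]
  exact Finset.sum_congr rfl fun i _ => by ring

theorem stmt13_cols {E : Type*} [Fintype E] [DecidableEq E]
    (P S : Matrix E E ℝ) (h : ∀ v : E → ℝ, P.mulVec v = v ↔ S.mulVec v = v)
    (M : Matrix E E ℝ) : P * M = M ↔ S * M = M := by
  have key : ∀ A : Matrix E E ℝ, A * M = M ↔ ∀ j, A.mulVec (M.col j) = M.col j := by
    intro A
    constructor
    · intro hA j
      ext i
      exact congrFun (congrFun hA i) j
    · intro hA
      ext i j
      exact congrFun (hA j) i
  rw [key, key]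
  simp only [h]

/-- Let `S` be a real symmetric matrix whose eigenvalues all lie in
`[−1+g, 1−g] ∪ {1}` for some `g ∈ (0,1)`, and let `P` be the orthogonal projection onto the
eigenspace `{v : S v = v}` (characterized as the symmetric idempotent matrix whose fixed
vectors are exactly that eigenspace). Then for every `λ > 0` the matrix `λI + 2(I − S)` is
invertible and for every `r ∈ ℕ` and vector `v`,
`0 ≤ ⟨v, (λI + 2(I − S))^{−(r+1)} (I − P) v⟩ ≤ ‖v‖² / (λ + 2g)^{r+1}`. -/
theorem stmt13 {E : Type*} [Fintype E] [DecidableEq E] [Nonempty E]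
    (S : Matrix E E ℝ) (hSsymm : S.IsSymm)
    (g : ℝ) (hg0 : 0 < g) (hg1 : g < 1)
    (hspec : spectrum ℝ S ⊆ Set.Icc (-1 + g) (1 - g) ∪ {1})
    (P : Matrix E E ℝ)
    (hPsymm : P.IsSymm) (hPidem : P * P = P)
    (hPrange : ∀ v : E → ℝ, P.mulVec v = v ↔ S.mulVec v = v)
    (lam : ℝ) (hlam : 0 < lam) :
    IsUnit (lam • (1 : Matrix E E ℝ) + 2 • ((1 : Matrix E E ℝ) - S)) ∧
    ∀ (r : ℕ) (v : E → ℝ),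
      0 ≤ v ⬝ᵥ (((lam • (1 : Matrix E E ℝ) + 2 • ((1 : Matrix E E ℝ) - S))⁻¹ ^ (r + 1)
            * (1 - P)).mulVec v) ∧
      v ⬝ᵥ (((lam • (1 : Matrix E E ℝ) + 2 • ((1 : Matrix E E ℝ) - S))⁻¹ ^ (r + 1)
            * (1 - P)).mulVec v) ≤ (v ⬝ᵥ v) / (lam + 2 * g) ^ (r + 1) := by
  obtain ⟨U, d, hUU, hUU', hSd, hd⟩ := stmt13_diag S hSsymm
  have hd' : ∀ i, d i ≤ 1 - g ∨ d i = 1 := fun i => by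
    rcases hspec (hd i) with h | h
    · exact Or.inl h.2
    · exact Or.inr h
  have hmul := stmt13_mul U hUU'
  have hone : (1 : Matrix E E ℝ) = U * diagonal (fun _ => (1 : ℝ)) * Uᵀ := by
    rw [diagonal_one, Matrix.mul_one, hUU]
  have hA : lam • (1 : Matrix E E ℝ) + 2 • ((1 : Matrix E E ℝ) - S)
      = U * diagonal (fun i => lam + 2 * (1 - d i)) * Uᵀ := by
    have : diagonal (fun i => lam + 2 * (1 - d i))
        = lam • (1 : Matrix E E ℝ) + (2 : ℕ) • ((1 : Matrix E E ℝ) - diagonal d) := by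
      ext i j
      by_cases hij : i = j
      · subst hij; simp [two_smul, two_mul, -nsmul_eq_mul]
      · simp [hij, two_smul, -nsmul_eq_mul]
    rw [this, hSd]
    simp only [Matrix.mul_add, Matrix.add_mul, Matrix.mul_sub, Matrix.sub_mul, Matrix.mul_smul,
      Matrix.smul_mul, Matrix.mul_one, hUU]
  have hpos : ∀ i, 0 < lam + 2 * (1 - d i) := fun i => by
    rcases hd' i with h | h <;> linarith
  have hAB : (lam • (1 : Matrix E E ℝ) + 2 • ((1 : Matrix E E ℝ) - S))
      * (U * diagonal (fun i => (lam + 2 * (1 - d i))⁻¹) * Uᵀ) = 1 := by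
    rw [hA, hmul, hone]
    congr 3
    ext i
    exact mul_inv_cancel₀ (hpos i).ne'
  have hinv := Matrix.inv_eq_right_inv hAB
  -- identify P
  set q : E → ℝ := fun i => if d i = 1 then 1 else 0 with hq
  have hSQ : S * (U * diagonal q * Uᵀ) = U * diagonal q * Uᵀ := by
    rw [hSd, hmul]
    congr 3
    ext i
    by_cases h : d i = 1 <;> simp [hq, h]
  have hPQ : P * (U * diagonal q * Uᵀ) = U * diagonal q * Uᵀ :=
    (stmt13_cols P S hPrange _).2 hSQ
  have hSP : S * P = P := (stmt13_cols P S hPrange _).1 hPidem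
  have hDP : diagonal d * (Uᵀ * P) = Uᵀ * P := by
    calc diagonal d * (Uᵀ * P) = (Uᵀ * U) * diagonal d * (Uᵀ * P) := by
          rw [hUU', Matrix.one_mul]
      _ = Uᵀ * (U * diagonal d * Uᵀ * P) := by simp only [Matrix.mul_assoc]
      _ = Uᵀ * P := by rw [← hSd, hSP]
  have hqP : diagonal q * (Uᵀ * P) = Uᵀ * P := by
    ext i j
    have h1 := congrFun (congrFun hDP i) j
    rw [diagonal_mul] at h1 ⊢
    by_cases h : d i = 1
    · simp [hq, h]
    · have h2 : (d i - 1) * (Uᵀ * P) i j = 0 := by linarith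
      rcases mul_eq_zero.1 h2 with h3 | h3
      · exact absurd (by linarith) h
      · rw [h3, mul_zero]
  have hQP : (U * diagonal q * Uᵀ) * P = P := by
    rw [Matrix.mul_assoc, Matrix.mul_assoc, hqP, ← Matrix.mul_assoc, hUU, Matrix.one_mul]
  have hP : P = U * diagonal q * Uᵀ := by
    have h := congrArg Matrix.transpose hPQ
    have hQt : (U * diagonal q * Uᵀ)ᵀ = U * diagonal q * Uᵀ := by
      simp [Matrix.transpose_mul, Matrix.mul_assoc]
    rw [Matrix.transpose_mul, hQt, hPsymm.eq, hQP] at h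
    exact h
  have hpow : ∀ n : ℕ, (U * diagonal (fun i => (lam + 2 * (1 - d i))⁻¹) * Uᵀ) ^ n
      = U * diagonal (fun i => (lam + 2 * (1 - d i))⁻¹ ^ n) * Uᵀ := by
    intro n
    induction n with
    | zero => simp only [pow_zero]; exact hone
    | succ n ih => rw [pow_succ, ih, hmul]; simp only [pow_succ]
  have h1P : 1 - P = U * diagonal (fun i => 1 - q i) * Uᵀ := by
    have : diagonal (fun i => 1 - q i) = diagonal (fun _ => (1 : ℝ)) - diagonal q := by
      rw [diagonal_sub]
    rw [this, Matrix.mul_sub, Matrix.sub_mul, ← hone, ← hP]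
  refine ⟨IsUnit.of_mul_eq_one _ hAB, fun r v => ?_⟩
  have hvv : v ⬝ᵥ v = ∑ i, (Uᵀ.mulVec v i) ^ 2 := by
    have := stmt13_quad U (fun _ => 1) v
    rw [← hone, one_mulVec] at this
    simpa using this
  rw [hinv, hpow, h1P, hmul, stmt13_quad, hvv, Finset.sum_div]
  have hc : ∀ i, 0 ≤ (lam + 2 * (1 - d i))⁻¹ ^ (r + 1) * (1 - q i) ∧
      (lam + 2 * (1 - d i))⁻¹ ^ (r + 1) * (1 - q i) ≤ ((lam + 2 * g) ^ (r + 1))⁻¹ := by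
    intro i
    have hg' : 0 < lam + 2 * g := by linarith
    by_cases h : d i = 1
    · simp only [hq, h, if_true, sub_self, mul_zero]
      exact ⟨le_refl _, by positivity⟩
    · have h2 := (hd' i).resolve_right h
      have h3 := hpos i
      simp only [hq, h, if_false, sub_zero, mul_one]
      refine ⟨by positivity, ?_⟩
      rw [← inv_pow]
      have h4 : (lam + 2 * (1 - d i))⁻¹ ≤ (lam + 2 * g)⁻¹ :=
        inv_anti₀ hg' (by linarith)
      exact pow_le_pow_left₀ (by positivity) h4 _
  constructor
  · exact Finset.sum_nonneg fun i _ => mul_nonneg (hc i).1 (sq_nonneg _)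
  · refine Finset.sum_le_sum fun i _ => ?_
    rw [div_eq_inv_mul]
    exact mul_le_mul_of_nonneg_right (hc i).2 (sq_nonneg _)
end
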